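/- arXiv:1702.06986 — 2 statements merged into one kernel-verified Lean document; each statement's English description precedes it below -/
import Mathlib

section
/- Let (Ω, P) be a probability space, p a positive integer, θ : Fin p → ℝ a fixed vector of parameters, and L, U : Fin p → Ω → ℝ measurable, defining for each j the random confidence interval CI_j(ω) = [L_j(ω), U_j(ω)]. Let s : Ω → Equiv.Perm (Fin p) be a measurable random permutation (the significance ranking) and R : Ω → ℕ a measurable random variable with R(ω) ≤ p; the selected set is S(ω) = { s(ω)(i) : i < R(ω) }, the R(ω) top-ranked indices. For each rank i let N_i = { ω : θ_{s(ω)(i)} ∉ CI_{s(ω)(i)}(ω) }. Let α ∈ (0,1). Suppose that for every rank i and every r ∈ {1, …, p}, P[N_i ∩ {R = r}] = α · P[R = r] (in particular each N_i has probability α, i.e. the intervals control the rank conditional coverage at level α, and noncoverage at each rank is independent of the selected-set size). Then the false coverage statement rate satisfies FCR = α · P[R ≥ 1], and hence FCR ≤ α. -/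
open MeasureTheory

/-- The event that the interval of a randomly selected parameter misses it is measurable. -/
theorem measurableSet_noncoverage {Ω ι : Type*} [MeasurableSpace Ω] [Finite ι]
    (θ : ι → ℝ) {L U : ι → Ω → ℝ} (hL : ∀ j, Measurable (L j)) (hU : ∀ j, Measurable (U j))
    {s : Ω → Equiv.Perm ι} (hs : ∀ π, MeasurableSet {ω | s ω = π}) (i : ι) :
    MeasurableSet {ω | θ (s ω i) ∉ Set.Icc (L (s ω i) ω) (U (s ω i) ω)} := by
  have h : {ω | θ (s ω i) ∉ Set.Icc (L (s ω i) ω) (U (s ω i) ω)} =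
      ⋃ π : Equiv.Perm ι, {ω | s ω = π} ∩ {ω | θ (π i) ∉ Set.Icc (L (π i) ω) (U (π i) ω)} := by
    ext ω
    simp
  rw [h]
  refine MeasurableSet.iUnion fun π => (hs π).inter ?_
  exact ((measurableSet_le (hL _) measurable_const).inter
    (measurableSet_le measurable_const (hU _))).compl

/-- The proportion of the first `r` ranks satisfying a property, read off their images under a
permutation. -/
theorem card_filter_image_perm_div_card {p r : ℕ} (hr : r ≤ p) (σ : Equiv.Perm (Fin p))
    (B : Fin p → Prop) [DecidablePred B] :
    (((((Finset.univ.filter fun i : Fin p => (i : ℕ) < r).image σ).filter B).card : ℝ) /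
      ((Finset.univ.filter fun i : Fin p => (i : ℕ) < r).image σ).card) =
      ∑ i ∈ Finset.univ.filter (fun i : Fin p => (i : ℕ) < r),
        (r : ℝ)⁻¹ * if B (σ i) then 1 else 0 := by
  rw [Finset.filter_image, Finset.card_image_of_injective _ σ.injective,
    Finset.card_image_of_injective _ σ.injective, Fin.card_filter_val_lt, min_eq_right hr,
    ← Finset.mul_sum, Finset.sum_boole, div_eq_inv_mul]

/-- A natural-number random variable bounded by `p` is positive with probability the sum of the
probabilities of the values `1, …, p`. -/
theorem sum_measureReal_eq_measureReal_one_le {Ω : Type*} [MeasurableSpace Ω] (P : Measure Ω)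
    [IsFiniteMeasure P] {p : ℕ} {R : Ω → ℕ} (hR : Measurable R) (hRp : ∀ ω, R ω ≤ p) :
    ∑ r ∈ Finset.Icc 1 p, P.real {ω | R ω = r} = P.real {ω | 1 ≤ R ω} := by
  have h : {ω | 1 ≤ R ω} = ⋃ r ∈ Finset.Icc 1 p, {ω | R ω = r} := by
    ext ω
    simp [hRp ω]
  rw [h, measureReal_biUnion_finset]
  · intro a _ b _ hab
    exact Set.disjoint_left.2 fun ω ha hb => hab (ha.symm.trans hb)
  · exact fun r _ => hR (measurableSet_singleton r)

/-- RCC control at level `α` at every rank, together with independence of rank-wise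
noncoverage from the selected-set size, implies the false coverage statement rate
equals `α · P[R ≥ 1]`, and hence is at most `α`. -/
theorem rcc_control_implies_fcr_eq
    {Ω : Type*} [MeasurableSpace Ω] (P : Measure Ω) [IsProbabilityMeasure P]
    (p : ℕ) (hp : 0 < p) (θ : Fin p → ℝ)
    (L U : Fin p → Ω → ℝ) (hL : ∀ j, Measurable (L j)) (hU : ∀ j, Measurable (U j))
    (s : Ω → Equiv.Perm (Fin p))
    (hs : ∀ π : Equiv.Perm (Fin p), MeasurableSet {ω | s ω = π})
    (R : Ω → ℕ) (hR : Measurable R) (hRp : ∀ ω, R ω ≤ p)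
    -- the selected set: the `R ω` top-ranked indices
    (S : Ω → Finset (Fin p))
    (hS : ∀ ω, S ω = (Finset.univ.filter (fun i : Fin p => (i : ℕ) < R ω)).image (s ω))
    -- the proportion of non-covering intervals among the selected set
    (Q : Ω → ℝ)
    (hQ : ∀ ω, Q ω =
      if (S ω).Nonempty then
        (((S ω).filter (fun j => θ j ∉ Set.Icc (L j ω) (U j ω))).card : ℝ) / (S ω).card
      else 0)
    (α : ℝ) (hα : α ∈ Set.Ioo (0 : ℝ) 1)
    -- RCC control at every rank, with noncoverage independent of the selection size
    (hrcc : ∀ (i : Fin p) (r : ℕ), 1 ≤ r → r ≤ p →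
      P ({ω | θ (s ω i) ∉ Set.Icc (L (s ω i) ω) (U (s ω i) ω)} ∩ {ω | R ω = r})
        = ENNReal.ofReal α * P {ω | R ω = r}) :
    (∫ ω, Q ω ∂P) = α * (P {ω | 1 ≤ R ω}).toReal ∧ (∫ ω, Q ω ∂P) ≤ α := by
  classical
  set N : Fin p → Set Ω := fun i => {ω | θ (s ω i) ∉ Set.Icc (L (s ω i) ω) (U (s ω i) ω)} with hN
  have hNm (i : Fin p) : MeasurableSet (N i) := measurableSet_noncoverage θ hL hU hs i
  have hRm (r : ℕ) : MeasurableSet {ω | R ω = r} := hR (measurableSet_singleton r)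
  have hQsum : Q = fun ω => ∑ r ∈ Finset.Icc 1 p,
      ∑ i ∈ Finset.univ.filter (fun i : Fin p => (i : ℕ) < r),
        (r : ℝ)⁻¹ * (N i ∩ {ω | R ω = r}).indicator 1 ω := by
    funext ω
    have hne : (S ω).Nonempty ↔ 1 ≤ R ω := by
      rw [← Finset.card_pos, hS, Finset.card_image_of_injective _ (s ω).injective,
        Fin.card_filter_val_lt, min_eq_right (hRp ω), Nat.succ_le_iff]
    have hoff (r : ℕ) (hr : R ω ≠ r) :
        ∑ i ∈ Finset.univ.filter (fun i : Fin p => (i : ℕ) < r),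
          (r : ℝ)⁻¹ * (N i ∩ {ω | R ω = r}).indicator 1 ω = 0 :=
      Finset.sum_eq_zero fun i _ => by simp [hr]
    rw [hQ]
    split_ifs with h
    · rw [Finset.sum_eq_single_of_mem (R ω) (Finset.mem_Icc.2 ⟨hne.1 h, hRp ω⟩)
        fun r _ hr => hoff r hr.symm]
      rw [hS]
      convert card_filter_image_perm_div_card (hRp ω) (s ω)
        (fun j => θ j ∉ Set.Icc (L j ω) (U j ω)) using 3 with i
      simp only [Set.indicator_apply, hN, Set.mem_inter_iff, Set.mem_ofPred_eq, and_true,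
        Pi.one_apply]
    · refine (Finset.sum_eq_zero fun r hr => hoff r ?_).symm
      rintro rfl
      exact h (hne.2 (Finset.mem_Icc.1 hr).1)
  have hint (r : ℕ) (i : Fin p) :
      Integrable (fun ω => (r : ℝ)⁻¹ * (N i ∩ {ω | R ω = r}).indicator 1 ω) P :=
    ((integrable_const (1 : ℝ)).indicator ((hNm i).inter (hRm r))).const_mul _
  have hFCR : ∫ ω, Q ω ∂P = α * (P {ω | 1 ≤ R ω}).toReal := by
    rw [hQsum, integral_finsetSum _ fun r _ => integrable_finsetSum _ fun i _ => hint r i,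
      ← measureReal_def, ← sum_measureReal_eq_measureReal_one_le P hR hRp, Finset.mul_sum]
    refine Finset.sum_congr rfl fun r hr => ?_
    obtain ⟨hr1, hrp⟩ := Finset.mem_Icc.1 hr
    have hterm (i : Fin p) : ∫ ω, (r : ℝ)⁻¹ * (N i ∩ {ω | R ω = r}).indicator 1 ω ∂P =
        (r : ℝ)⁻¹ * (α * P.real {ω | R ω = r}) := by
      rw [integral_const_mul, integral_indicator_one ((hNm i).inter (hRm r)), measureReal_def,
        hrcc i r hr1 hrp, ENNReal.toReal_mul, ENNReal.toReal_ofReal hα.1.le, measureReal_def]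
    have hr0 : (r : ℝ) ≠ 0 := by positivity
    rw [integral_finsetSum _ fun i _ => hint r i, Finset.sum_congr rfl fun i _ => hterm i,
      Finset.sum_const, Fin.card_filter_val_lt, min_eq_right hrp, nsmul_eq_mul,
      mul_inv_cancel_left₀ hr0]
  refine ⟨hFCR, hFCR.trans_le ?_⟩
  exact mul_le_of_le_one_right hα.1.le measureReal_le_one
end

section
/- Let (Ω, P) be a probability space, p a positive integer, θ : Fin p → ℝ a fixed vector of parameters, and L, U : Fin p → Ω → ℝ measurable, defining for each j the random confidence interval CI_j(ω) = [L_j(ω), U_j(ω)]. Let s : Ω → Equiv.Perm (Fin p) be a measurable random permutation (the significance ranking) and R : Ω → ℕ a measurable random variable with R(ω) ≤ p; the selected set is S(ω) = { s(ω)(i) : i < R(ω) }, the R(ω) top-ranked indices. For each rank i let N_i = { ω : θ_{s(ω)(i)} ∉ CI_{s(ω)(i)}(ω) }. Let α ∈ (0,1). Suppose that for every rank i and every r ∈ {1, …, p} with i < r, P[N_i ∩ {R = r}] ≤ α · P[R = r]. Then the false coverage statement rate satisfies FCR ≤ α · P[R ≥ 1] ≤ α. -/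
open MeasureTheory

/-- The set of outcomes at which a property of a randomly permuted index holds is measurable. -/
theorem measurableSet_setOf_perm_apply {Ω : Type*} [MeasurableSpace Ω] {ι : Type*} [Finite ι]
    {s : Ω → Equiv.Perm ι} (hs : ∀ π : Equiv.Perm ι, MeasurableSet {ω | s ω = π})
    {A : ι → Set Ω} (hA : ∀ j, MeasurableSet (A j)) (i : ι) :
    MeasurableSet {ω | ω ∈ A (s ω i)} := by
  have h : {ω | ω ∈ A (s ω i)} = ⋃ π : Equiv.Perm ι, {ω | s ω = π} ∩ A (π i) := by
    ext ω
    simp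
  rw [h]
  exact MeasurableSet.iUnion fun π => (hs π).inter (hA (π i))

/-- The proportion of indices with property `b` among the `r` top-ranked ones is the average over
the first `r` ranks of the indicator of `b`. -/
theorem card_filter_image_div_card_eq_sum {p r : ℕ} (hr : r ≤ p) (σ : Equiv.Perm (Fin p))
    (b : Fin p → Prop) [DecidablePred b] :
    (((((Finset.univ.filter (fun i : Fin p => (i : ℕ) < r)).image σ).filter b).card : ℝ) /
      ((Finset.univ.filter (fun i : Fin p => (i : ℕ) < r)).image σ).card) =
      ∑ i ∈ Finset.univ.filter (fun i : Fin p => (i : ℕ) < r),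
        (r : ℝ)⁻¹ * (if b (σ i) then 1 else 0) := by
  rw [Finset.filter_image, Finset.card_image_of_injective _ σ.injective,
    Finset.card_image_of_injective _ σ.injective, Fin.card_filter_val_lt, min_eq_right hr,
    ← Finset.mul_sum, Finset.sum_boole, div_eq_inv_mul]

/-- Conservative form of Theorem 1: if at every selected rank `i < r` the rank
conditional noncoverage probability (jointly with `{R = r}`) is at most
`α · P[R = r]`, then the false coverage statement rate is at most
`α · P[R ≥ 1] ≤ α`. -/
theorem rcc_control_implies_fcr_le
    {Ω : Type*} [MeasurableSpace Ω] (P : Measure Ω) [IsProbabilityMeasure P]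
    (p : ℕ) (hp : 0 < p) (θ : Fin p → ℝ)
    (L U : Fin p → Ω → ℝ) (hL : ∀ j, Measurable (L j)) (hU : ∀ j, Measurable (U j))
    (s : Ω → Equiv.Perm (Fin p))
    (hs : ∀ π : Equiv.Perm (Fin p), MeasurableSet {ω | s ω = π})
    (R : Ω → ℕ) (hR : Measurable R) (hRp : ∀ ω, R ω ≤ p)
    -- the selected set: the `R ω` top-ranked indices
    (S : Ω → Finset (Fin p))
    (hS : ∀ ω, S ω = (Finset.univ.filter (fun i : Fin p => (i : ℕ) < R ω)).image (s ω))
    -- the proportion of non-covering intervals among the selected set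
    (Q : Ω → ℝ)
    (hQ : ∀ ω, Q ω =
      if (S ω).Nonempty then
        (((S ω).filter (fun j => θ j ∉ Set.Icc (L j ω) (U j ω))).card : ℝ) / (S ω).card
      else 0)
    (α : ℝ) (hα : α ∈ Set.Ioo (0 : ℝ) 1)
    -- rank conditional noncoverage control at the selected ranks
    (hrcc : ∀ (i : Fin p) (r : ℕ), 1 ≤ r → r ≤ p → (i : ℕ) < r →
      P ({ω | θ (s ω i) ∉ Set.Icc (L (s ω i) ω) (U (s ω i) ω)} ∩ {ω | R ω = r})
        ≤ ENNReal.ofReal α * P {ω | R ω = r}) :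
    (∫ ω, Q ω ∂P) ≤ α * (P {ω | 1 ≤ R ω}).toReal ∧
      α * (P {ω | 1 ≤ R ω}).toReal ≤ α := by
  classical
  obtain ⟨hα0, -⟩ := hα
  refine ⟨?_, mul_le_of_le_one_right hα0.le measureReal_le_one⟩
  set N : Fin p → Set Ω :=
    fun i => {ω | θ (s ω i) ∉ Set.Icc (L (s ω i) ω) (U (s ω i) ω)} with hN
  set T : ℕ → Finset (Fin p) := fun r => Finset.univ.filter (fun i : Fin p => (i : ℕ) < r) with hT
  have hTcard : ∀ r ≤ p, (T r).card = r := fun r hr => by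
    rw [hT, Fin.card_filter_val_lt, min_eq_right hr]
  have hNm : ∀ i, MeasurableSet (N i) := fun i =>
    measurableSet_setOf_perm_apply hs (A := fun j => {ω | θ j ∉ Set.Icc (L j ω) (U j ω)})
      (fun j => ((measurableSet_le (hL j) measurable_const).inter
        (measurableSet_le measurable_const (hU j))).compl) i
  have hRm : ∀ r, MeasurableSet {ω | R ω = r} := fun r => hR (measurableSet_singleton r)
  have hQsum : ∀ ω, Q ω = ∑ r ∈ Finset.Icc 1 p, ∑ i ∈ T r,
      (r : ℝ)⁻¹ * (N i ∩ {ω | R ω = r}).indicator 1 ω := by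
    intro ω
    have hQ' : Q ω = ∑ i ∈ T (R ω), (R ω : ℝ)⁻¹ * (N i).indicator 1 ω := by
      have h := card_filter_image_div_card_eq_sum (hRp ω) (s ω)
        (fun j => θ j ∉ Set.Icc (L j ω) (U j ω))
      rw [← hS ω] at h
      have hdiv : Q ω = (((S ω).filter
          (fun j => θ j ∉ Set.Icc (L j ω) (U j ω))).card : ℝ) / (S ω).card := by
        rw [hQ ω]
        split_ifs with hne
        · rfl
        · simp [Finset.not_nonempty_iff_eq_empty.mp hne]
      rw [hdiv]
      refine h.trans (Finset.sum_congr rfl fun i _ => ?_)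
      simp only [Set.indicator_apply, hN, Set.mem_ofPred_eq, Pi.one_apply]
    have hzero : ∀ r, r ≠ R ω →
        ∑ i ∈ T r, (r : ℝ)⁻¹ * (N i ∩ {ω | R ω = r}).indicator 1 ω = 0 := fun r hr =>
      Finset.sum_eq_zero fun i _ => by simp [Set.indicator, hr.symm]
    rw [hQ', Finset.sum_eq_single (R ω) (fun r _ => hzero r)]
    · simp [Set.indicator]
    · intro h
      have h0 : R ω = 0 := by
        have := hRp ω
        simp only [Finset.mem_Icc] at h
        omega
      simp [h0]
  have hint : ∀ (r : ℕ) (i : Fin p),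
      Integrable (fun ω => (r : ℝ)⁻¹ * (N i ∩ {ω | R ω = r}).indicator 1 ω) P := fun r i =>
    (((integrable_const (1 : ℝ)).indicator ((hNm i).inter (hRm r))).const_mul _)
  have hPR : P.real {ω | 1 ≤ R ω} = ∑ r ∈ Finset.Icc 1 p, P.real {ω | R ω = r} := by
    rw [← measureReal_biUnion_finset _ fun r _ => hRm r]
    · congr 1
      ext ω
      simp [hRp ω]
    · intro a _ b _ hab
      exact Set.disjoint_left.mpr fun ω ha hb => hab (ha.symm.trans hb)
  calc ∫ ω, Q ω ∂P
      = ∑ r ∈ Finset.Icc 1 p, ∑ i ∈ T r, (r : ℝ)⁻¹ * P.real (N i ∩ {ω | R ω = r}) := by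
        simp_rw [hQsum]
        rw [integral_finsetSum _ fun r _ => integrable_finsetSum _ fun i _ => hint r i]
        refine Finset.sum_congr rfl fun r _ => ?_
        rw [integral_finsetSum _ fun i _ => hint r i]
        refine Finset.sum_congr rfl fun i _ => ?_
        rw [integral_const_mul, integral_indicator_one ((hNm i).inter (hRm r))]
    _ ≤ ∑ r ∈ Finset.Icc 1 p, α * P.real {ω | R ω = r} := by
        refine Finset.sum_le_sum fun r hr => ?_
        obtain ⟨h1, hp'⟩ := Finset.mem_Icc.mp hr
        have hle : ∀ i ∈ T r, (r : ℝ)⁻¹ * P.real (N i ∩ {ω | R ω = r}) ≤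
            (r : ℝ)⁻¹ * (α * P.real {ω | R ω = r}) := by
          intro i hi
          have h := ENNReal.toReal_mono (by finiteness)
            (hrcc i r h1 hp' (Finset.mem_filter.mp hi).2)
          rw [ENNReal.toReal_mul, ENNReal.toReal_ofReal hα0.le] at h
          exact mul_le_mul_of_nonneg_left h (by positivity)
        refine (Finset.sum_le_card_nsmul _ _ _ hle).trans_eq ?_
        have hr0 : (r : ℝ) ≠ 0 := by positivity
        rw [hTcard r hp', nsmul_eq_mul, mul_inv_cancel_left₀ hr0]
    _ = α * (P {ω | 1 ≤ R ω}).toReal := by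
        rw [← Finset.mul_sum, ← hPR, measureReal_def]
end
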